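/- Let g satisfy the Fermi conditions (F1) and (F2) on U, fix (x₁,0,0)∈U and ψ∈ℝ, and for each θ∈[−1,1] let γ_θ be the maximal smooth solution of the geodesic equation d²γ^k/dt² = Σ_{i,j} Γ_{ij}{}^k(γ(t))·(dγ^i/dt)(dγ^j/dt) with γ_θ(0)=(x₁,0,0) and γ_θ'(0)=(cosθ, cosψ·sinθ, sinψ·sinθ). Set γ_θ^⊥(t) = ⟨γ_θ(t), (0,−sinψ, cosψ)⟩. Then γ_θ''(0)=0, and there is a constant C, depending on g, x₁ and ψ but not on θ, such that for all θ∈[−1,1]: |d³γ_θ^⊥/dt³(0) − ρ(x₁,ψ)·cos²θ·sinθ| ≤ C·θ², where 2ρ(x₁,ψ) = (cosψ·∂₂ + sinψ·∂₃)(sinψ·∂₂ − cosψ·∂₃)g₁₁(x₁,0,0). (The paper's Corollary 3.3, equations (3.11) and (3.12).) -/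

import Mathlib

open Set

noncomputable section

/-- Points of `ℝ³` as functions `Fin 3 → ℝ`. -/
abbrev R3 : Type := Fin 3 → ℝ

/-- 3×3 real matrices. -/
abbrev Mat3 : Type := Matrix (Fin 3) (Fin 3) ℝ

/-- The partial derivative `∂_i f` of a scalar function on `ℝ³`. -/
def pd (i : Fin 3) (f : R3 → ℝ) : R3 → ℝ := fun x => fderiv ℝ f x (Pi.single i 1)

/-- The point `(x₁, 0, 0)` on the axis. -/
def axisPt (x₁ : ℝ) : R3 := ![x₁, 0, 0]

/-- The lowered Christoffel symbols `Γ_{ijk} = (∂_j g_{ik} + ∂_i g_{jk} - ∂_k g_{ij})/2`. -/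
def Γlow (g : R3 → Mat3) (i j k : Fin 3) : R3 → ℝ := fun x =>
  (pd j (fun y => g y i k) x + pd i (fun y => g y j k) x - pd k (fun y => g y i j) x) / 2

/-- The raised Christoffel symbols `Γ_{ij}{}^k = Σ_l Γ_{ijl} g^{lk}`. -/
def Γup (g ginv : R3 → Mat3) (i j k : Fin 3) : R3 → ℝ := fun x =>
  ∑ l : Fin 3, Γlow g i j l x * ginv x l k

/-- Fermi condition (F1) (indices are 0-based: paper's `x₁,x₂,x₃` are `x 0, x 1, x 2`):
`Σ_{k=2}^{3} g_{jk}(x) x_k = x_j` for `j = 2,3` and `Σ_{k=2}^{3} g_{1k}(x) x_k = 0`. -/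
def FermiF1 (g : R3 → Mat3) (U : Set R3) : Prop :=
  ∀ x ∈ U, ∀ j : Fin 3, g x j 1 * x 1 + g x j 2 * x 2 = if j = 0 then 0 else x j

/-- Fermi condition (F2): `g_{jk} = δ_{jk}` and `∂₂ g_{jk} = ∂₃ g_{jk} = 0` on the axis. -/
def FermiF2 (g : R3 → Mat3) (U : Set R3) : Prop :=
  ∀ x₁ : ℝ, axisPt x₁ ∈ U →
    (∀ j k : Fin 3, g (axisPt x₁) j k = if j = k then 1 else 0) ∧
    (∀ j k : Fin 3, pd 1 (fun y => g y j k) (axisPt x₁) = 0 ∧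
      pd 2 (fun y => g y j k) (axisPt x₁) = 0)

/-- `γ` solves the geodesic equation
`d²γ^k/dt² = Σ_{i,j} Γ_{ij}{}^k(γ(t)) (dγ^i/dt)(dγ^j/dt)` on `(-T,T)`. -/
def IsGeodesic (g ginv : R3 → Mat3) (γ : ℝ → R3) (T : ℝ) : Prop :=
  ∀ t ∈ Set.Ioo (-T) T, ∀ k : Fin 3,
    iteratedDeriv 2 γ t k =
      ∑ i : Fin 3, ∑ j : Fin 3, Γup g ginv i j k (γ t) * deriv γ t i * deriv γ t j

theorem ContinuousLinearMap.iteratedDeriv_comp_left {E F : Type*} [NormedAddCommGroup E]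
    [NormedSpace ℝ E] [NormedAddCommGroup F] [NormedSpace ℝ F] (L : E →L[ℝ] F) {γ : ℝ → E} {t : ℝ}
    {n : ℕ} (hγ : ContDiffAt ℝ n γ t) :
    iteratedDeriv n (fun s => L (γ s)) t = L (iteratedDeriv n γ t) := by
  have h := L.iteratedFDeriv_comp_left (i := n) hγ le_rfl
  rw [iteratedDeriv_eq_iteratedFDeriv, iteratedDeriv_eq_iteratedFDeriv]
  exact congrArg (fun A => A fun _ => (1 : ℝ)) h

theorem ContDiffAt.differentiableAt_iteratedDeriv {E : Type*} [NormedAddCommGroup E]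
    [NormedSpace ℝ E] {γ : ℝ → E} {t : ℝ} {n : ℕ} (hγ : ContDiffAt ℝ (n + 1 : ℕ) γ t) :
    DifferentiableAt ℝ (iteratedDeriv n γ) t := by
  have h : ContDiffWithinAt ℝ (n + 1 : ℕ) γ univ t := hγ.contDiffWithinAt
  have h' := h.differentiableWithinAt_iteratedDerivWithin (m := n)
    (by exact_mod_cast Nat.lt_succ_self n) (by simp)
  rwa [iteratedDerivWithin_univ, differentiableWithinAt_univ] at h'

section PartialDerivatives

variable {U : Set R3} {f : R3 → ℝ}

theorem contDiffOn_pd (hU : IsOpen U) (hf : ContDiffOn ℝ (⊤ : ℕ∞) f U) (i : Fin 3) :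
    ContDiffOn ℝ (⊤ : ℕ∞) (pd i f) U :=
  (hf.fderiv_of_isOpen hU (by simp)).clm_apply contDiffOn_const

theorem ContDiffOn.differentiableAt_of_isOpen (hU : IsOpen U) (hf : ContDiffOn ℝ (⊤ : ℕ∞) f U)
    {p : R3} (hp : p ∈ U) : DifferentiableAt ℝ f p :=
  (hf.contDiffAt (hU.mem_nhds hp)).differentiableAt (by simp)

theorem pd_comm (hU : IsOpen U) (hf : ContDiffOn ℝ (⊤ : ℕ∞) f U) {p : R3} (hp : p ∈ U)
    (i j : Fin 3) : pd i (pd j f) p = pd j (pd i f) p := by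
  have hfp : ContDiffAt ℝ (⊤ : ℕ∞) f p := hf.contDiffAt (hU.mem_nhds hp)
  have hd : DifferentiableAt ℝ (fderiv ℝ f) p :=
    ((contDiffAt_infty.mp hfp 2).fderiv_right (m := 1) (by norm_num)).differentiableAt (by simp)
  have happ (a b : Fin 3) :
      pd a (pd b f) p = fderiv ℝ (fderiv ℝ f) p (Pi.single a 1) (Pi.single b 1) := by
    have h := (hd.hasFDerivAt.clm_apply (hasFDerivAt_const (Pi.single b (1 : ℝ) : R3) p)).fderiv
    change fderiv ℝ (fun y => fderiv ℝ f y (Pi.single b 1)) p (Pi.single a 1) = _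
    rw [h]
    simp
  rw [happ, happ]
  exact (contDiffAt_infty.mp hfp 2).isSymmSndFDerivAt (by simp) _ _

theorem pd_zero_eq_zero_of_const_on_axis (hU : IsOpen U) {x₁ : ℝ} (hx : axisPt x₁ ∈ U)
    (hf : DifferentiableAt ℝ f (axisPt x₁)) {c : ℝ} (hc : ∀ s, axisPt s ∈ U → f (axisPt s) = c) :
    pd 0 f (axisPt x₁) = 0 := by
  have haxis : HasDerivAt axisPt (Pi.single 0 1) x₁ := by
    rw [hasDerivAt_pi]
    intro i
    fin_cases i
    · simpa [axisPt] using hasDerivAt_id' x₁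
    · simpa [axisPt] using hasDerivAt_const x₁ (0 : ℝ)
    · simpa [axisPt] using hasDerivAt_const x₁ (0 : ℝ)
  have hcomp := hf.hasFDerivAt.comp_hasDerivAt x₁ haxis
  refine hcomp.unique ((hasDerivAt_const x₁ c).congr_of_eventuallyEq ?_)
  filter_upwards [haxis.continuousAt.preimage_mem_nhds (hU.mem_nhds hx)] with s hs
  exact hc s hs

theorem HasDerivAt.comp_pd {γ : ℝ → R3} {v : R3} {t : ℝ} (hf : DifferentiableAt ℝ f (γ t))
    (hγ : HasDerivAt γ v t) :
    HasDerivAt (fun s => f (γ s)) (∑ m, pd m f (γ t) * v m) t := by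
  refine (hf.hasFDerivAt.comp_hasDerivAt t hγ).congr_deriv (Eq.symm ?_)
  calc ∑ m, pd m f (γ t) * v m
      = fderiv ℝ f (γ t) (∑ m, v m • (Pi.single m 1 : R3)) := by simp [pd, map_sum, mul_comm]
    _ = fderiv ℝ f (γ t) v := by rw [← pi_eq_sum_univ' v]

theorem pd_add {f₁ f₂ : R3 → ℝ} {p : R3} (h₁ : DifferentiableAt ℝ f₁ p)
    (h₂ : DifferentiableAt ℝ f₂ p) (i : Fin 3) :
    pd i (fun x => f₁ x + f₂ x) p = pd i f₁ p + pd i f₂ p := by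
  simp [pd, fderiv_fun_add h₁ h₂]

theorem pd_const_mul {p : R3} (hf : DifferentiableAt ℝ f p) (c : ℝ) (i : Fin 3) :
    pd i (fun x => c * f x) p = c * pd i f p := by
  simp [pd, fderiv_const_mul hf c]

end PartialDerivatives

section Christoffel

variable {g ginv : R3 → Mat3} {U : Set R3} {x₁ : ℝ}

theorem contDiffOn_Γlow (hU : IsOpen U)
    (hg : ∀ i j : Fin 3, ContDiffOn ℝ (⊤ : ℕ∞) (fun x => g x i j) U) (i j k : Fin 3) :
    ContDiffOn ℝ (⊤ : ℕ∞) (Γlow g i j k) U :=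
  (((contDiffOn_pd hU (hg i k) j).add (contDiffOn_pd hU (hg j k) i)).sub
    (contDiffOn_pd hU (hg i j) k)).div_const 2

theorem pd_metric_axis (hU : IsOpen U)
    (hg : ∀ i j : Fin 3, ContDiffOn ℝ (⊤ : ℕ∞) (fun x => g x i j) U) (hF2 : FermiF2 g U)
    (hx : axisPt x₁ ∈ U) (m i j : Fin 3) : pd m (fun y => g y i j) (axisPt x₁) = 0 := by
  fin_cases m
  · exact pd_zero_eq_zero_of_const_on_axis hU hx ((hg i j).differentiableAt_of_isOpen hU hx)
      fun s hs => (hF2 s hs).1 i j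
  · exact ((hF2 x₁ hx).2 i j).1
  · exact ((hF2 x₁ hx).2 i j).2

theorem Γlow_axis (hU : IsOpen U)
    (hg : ∀ i j : Fin 3, ContDiffOn ℝ (⊤ : ℕ∞) (fun x => g x i j) U) (hF2 : FermiF2 g U)
    (hx : axisPt x₁ ∈ U) (i j k : Fin 3) : Γlow g i j k (axisPt x₁) = 0 := by
  simp [Γlow, pd_metric_axis hU hg hF2 hx]

theorem pd_zero_Γlow_axis (hU : IsOpen U)
    (hg : ∀ i j : Fin 3, ContDiffOn ℝ (⊤ : ℕ∞) (fun x => g x i j) U) (hF2 : FermiF2 g U)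
    (hx : axisPt x₁ ∈ U) (i j k : Fin 3) : pd 0 (Γlow g i j k) (axisPt x₁) = 0 :=
  pd_zero_eq_zero_of_const_on_axis hU hx
    ((contDiffOn_Γlow hU hg i j k).differentiableAt_of_isOpen hU hx)
    fun _ hs => Γlow_axis hU hg hF2 hs i j k

theorem pd_pd_zero_metric_axis (hU : IsOpen U)
    (hg : ∀ i j : Fin 3, ContDiffOn ℝ (⊤ : ℕ∞) (fun x => g x i j) U) (hF2 : FermiF2 g U)
    (hx : axisPt x₁ ∈ U) (m i j : Fin 3) :
    pd m (pd 0 fun y => g y i j) (axisPt x₁) = 0 := by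
  rw [pd_comm hU (hg i j) hx]
  exact pd_zero_eq_zero_of_const_on_axis hU hx
    ((contDiffOn_pd hU (hg i j) m).differentiableAt_of_isOpen hU hx)
    fun _ hs => pd_metric_axis hU hg hF2 hs m i j

theorem pd_Γlow_zero_zero_axis (hU : IsOpen U)
    (hg : ∀ i j : Fin 3, ContDiffOn ℝ (⊤ : ℕ∞) (fun x => g x i j) U) (hF2 : FermiF2 g U)
    (hx : axisPt x₁ ∈ U) (m k : Fin 3) :
    pd m (Γlow g 0 0 k) (axisPt x₁) = -(pd m (pd k fun y => g y 0 0) (axisPt x₁)) / 2 := by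
  have hd (i j l : Fin 3) : DifferentiableAt ℝ (pd l fun y => g y i j) (axisPt x₁) :=
    (contDiffOn_pd hU (hg i j) l).differentiableAt_of_isOpen hU hx
  have heq : Γlow g 0 0 k = fun x =>
      1 * pd 0 (fun y => g y 0 k) x + (-1 / 2) * pd k (fun y => g y 0 0) x := by
    funext x
    simp only [Γlow]
    ring
  rw [heq, pd_add ((hd 0 k 0).const_mul _) ((hd 0 0 k).const_mul _), pd_const_mul (hd 0 k 0),
    pd_const_mul (hd 0 0 k), pd_pd_zero_metric_axis hU hg hF2 hx]
  ring

theorem sum_Γup_mul_metric {x : R3} (hinv : g x * ginv x = 1) (i j l : Fin 3) :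
    ∑ k, Γup g ginv i j k x * g x k l = Γlow g i j l x := by
  have hinv' : ginv x * g x = 1 := mul_eq_one_comm.mp hinv
  have hentry (a : Fin 3) : ∑ k, ginv x a k * g x k l = (1 : Mat3) a l := by
    rw [← hinv', Matrix.mul_apply]
  calc ∑ k, Γup g ginv i j k x * g x k l
      = ∑ a, Γlow g i j a x * ∑ k, ginv x a k * g x k l := by
        simp only [Γup, Finset.sum_mul, Finset.mul_sum]
        rw [Finset.sum_comm]
        simp only [mul_assoc]
    _ = Γlow g i j l x := by simp [hentry, Matrix.one_apply]

end Christoffel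

section Geodesic

variable {g ginv : R3 → Mat3} {U : Set R3} {x₁ T : ℝ} {γ : ℝ → R3}

theorem IsGeodesic.lowered (hinv : ∀ x ∈ U, g x * ginv x = 1)
    (hmaps : MapsTo γ (Ioo (-T) T) U) (hgeo : IsGeodesic g ginv γ T) {t : ℝ}
    (ht : t ∈ Ioo (-T) T) (l : Fin 3) :
    ∑ k, iteratedDeriv 2 γ t k * g (γ t) k l =
      ∑ i, ∑ j, Γlow g i j l (γ t) * (deriv γ t i * deriv γ t j) := by
  simp only [hgeo t ht, ← sum_Γup_mul_metric (hinv _ (hmaps ht)), Finset.sum_mul]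
  rw [Finset.sum_comm]
  refine Finset.sum_congr rfl fun i _ => ?_
  rw [Finset.sum_comm]
  exact Finset.sum_congr rfl fun j _ => Finset.sum_congr rfl fun k _ => by ring

theorem IsGeodesic.iteratedDeriv_two_eq_zero (hU : IsOpen U)
    (hg : ∀ i j : Fin 3, ContDiffOn ℝ (⊤ : ℕ∞) (fun x => g x i j) U) (hF2 : FermiF2 g U)
    (hx : axisPt x₁ ∈ U) (hT : 0 < T) (hgeo : IsGeodesic g ginv γ T) (h0 : γ 0 = axisPt x₁) :
    iteratedDeriv 2 γ 0 = 0 := by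
  funext k
  simp [hgeo 0 ⟨by linarith, hT⟩ k, Γup, h0, Γlow_axis hU hg hF2 hx]

theorem IsGeodesic.iteratedDeriv_three (hU : IsOpen U)
    (hg : ∀ i j : Fin 3, ContDiffOn ℝ (⊤ : ℕ∞) (fun x => g x i j) U)
    (hinv : ∀ x ∈ U, g x * ginv x = 1) (hF2 : FermiF2 g U) (hx : axisPt x₁ ∈ U) (hT : 0 < T)
    (hγ : ContDiffOn ℝ (⊤ : ℕ∞) γ (Ioo (-T) T)) (hmaps : MapsTo γ (Ioo (-T) T) U)
    (hgeo : IsGeodesic g ginv γ T) (h0 : γ 0 = axisPt x₁) (l : Fin 3) :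
    iteratedDeriv 3 γ 0 l = ∑ i, ∑ j, (∑ m, pd m (Γlow g i j l) (axisPt x₁) * deriv γ 0 m) *
      (deriv γ 0 i * deriv γ 0 j) := by
  have h0mem : (0 : ℝ) ∈ Ioo (-T) T := ⟨by linarith, hT⟩
  have hγ0 : ContDiffAt ℝ (⊤ : ℕ∞) γ 0 := hγ.contDiffAt (isOpen_Ioo.mem_nhds h0mem)
  have hdiff (n : ℕ) : DifferentiableAt ℝ (iteratedDeriv n γ) 0 :=
    (contDiffAt_infty.mp hγ0 (n + 1)).differentiableAt_iteratedDeriv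
  have hd0 : HasDerivAt γ (deriv γ 0) 0 := by simpa using (hdiff 0).hasDerivAt
  have hd1 : HasDerivAt (deriv γ) 0 0 := by
    have h := (hdiff 1).hasDerivAt
    rwa [← iteratedDeriv_succ, hgeo.iteratedDeriv_two_eq_zero hU hg hF2 hx hT h0,
      iteratedDeriv_one] at h
  have hd2 : HasDerivAt (iteratedDeriv 2 γ) (iteratedDeriv 3 γ 0) 0 := by
    simpa [iteratedDeriv_succ (n := 2)] using (hdiff 2).hasDerivAt
  have hlhs : HasDerivAt (fun t => ∑ k, iteratedDeriv 2 γ t k * g (γ t) k l)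
      (iteratedDeriv 3 γ 0 l) 0 := by
    have h := HasDerivAt.fun_sum (u := Finset.univ) fun k _ =>
      (hasDerivAt_pi.mp hd2 k).mul (HasDerivAt.comp_pd (f := fun x => g x k l)
        ((hg k l).differentiableAt_of_isOpen hU (hmaps h0mem)) hd0)
    refine h.congr_deriv ?_
    simp [hgeo.iteratedDeriv_two_eq_zero hU hg hF2 hx hT h0, h0, (hF2 x₁ hx).1]
  have hrhs : HasDerivAt
      (fun t => ∑ i, ∑ j, Γlow g i j l (γ t) * (deriv γ t i * deriv γ t j))
      (∑ i, ∑ j, (∑ m, pd m (Γlow g i j l) (axisPt x₁) * deriv γ 0 m) *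
        (deriv γ 0 i * deriv γ 0 j)) 0 := by
    have h := HasDerivAt.fun_sum (u := Finset.univ) fun i _ =>
      HasDerivAt.fun_sum (u := Finset.univ) fun j _ =>
        (HasDerivAt.comp_pd (f := Γlow g i j l)
          ((contDiffOn_Γlow hU hg i j l).differentiableAt_of_isOpen hU (hmaps h0mem)) hd0).mul
        ((hasDerivAt_pi.mp hd1 i).mul (hasDerivAt_pi.mp hd1 j))
    refine h.congr_deriv ?_
    simp [h0]
  refine hlhs.unique (hrhs.congr_of_eventuallyEq ?_)
  filter_upwards [isOpen_Ioo.mem_nhds h0mem] with t ht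
  exact hgeo.lowered hinv hmaps ht l

end Geodesic

/-- A cubic form in `v` whose coefficients with first index `0` vanish is determined, up to an error
quadratic in the transverse components of `v`, by its coefficients with last two indices `0`. -/
theorem abs_cubic_sub_le (B : Fin 3 → Fin 3 → Fin 3 → ℝ) (hB : ∀ i j, B i j 0 = 0) (v : R3)
    (s : ℝ) (hv0 : |v 0| ≤ 1) (hs : |s| ≤ 1) (hv1 : |v 1| ≤ |s|) (hv2 : |v 2| ≤ |s|) :
    |(∑ i, ∑ j, (∑ m, B i j m * v m) * (v i * v j)) - (B 0 0 1 * v 1 + B 0 0 2 * v 2) * v 0 ^ 2| ≤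
      (∑ i, ∑ j, ∑ m, |B i j m|) * s ^ 2 := by
  have hv (i : Fin 3) : |v i| ≤ 1 := by
    fin_cases i
    exacts [hv0, hv1.trans hs, hv2.trans hs]
  have hs2 : s ^ 2 = |s| * |s| := by rw [← sq, sq_abs]
  have hsplit : (∑ i, ∑ j, (∑ m, B i j m * v m) * (v i * v j)) -
      (B 0 0 1 * v 1 + B 0 0 2 * v 2) * v 0 ^ 2 =
      ∑ i, ∑ j, ∑ m, if i = 0 ∧ j = 0 then 0 else B i j m * (v m * (v i * v j)) := by
    simp [Fin.sum_univ_three, hB]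
    ring
  rw [hsplit]
  simp only [Finset.sum_mul]
  refine (Finset.abs_sum_le_sum_abs _ _).trans (Finset.sum_le_sum fun i _ => ?_)
  refine (Finset.abs_sum_le_sum_abs _ _).trans (Finset.sum_le_sum fun j _ => ?_)
  refine (Finset.abs_sum_le_sum_abs _ _).trans (Finset.sum_le_sum fun m _ => ?_)
  split_ifs with hij
  · simpa using by positivity
  by_cases hm : m = 0
  · simp [hm, hB]
  have htrans {a : Fin 3} (ha : a ≠ 0) : |v a| ≤ |s| := by
    fin_cases a
    exacts [absurd rfl ha, hv1, hv2]
  rw [abs_mul, abs_mul, abs_mul, hs2]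
  have hvij : |v i| * |v j| ≤ |s| := by
    rcases not_and_or.mp hij with hi | hj
    · simpa using mul_le_mul (htrans hi) (hv j) (abs_nonneg _) (abs_nonneg _)
    · simpa using mul_le_mul (hv i) (htrans hj) (abs_nonneg _) zero_le_one
  have := htrans hm
  gcongr

/-- the paper's Corollary 3.3, equations (3.11) and (3.12): for geodesics
with `γ(0) = (x₁,0,0)`, `γ'(0) = (cos θ, cos ψ sin θ, sin ψ sin θ)` and
`γ^⊥(t) = ⟨γ(t), (0, -sin ψ, cos ψ)⟩`, one has `γ''(0) = 0` and
`|d³γ^⊥/dt³(0) - ρ(x₁,ψ) cos²θ sinθ| ≤ C θ²` with `C` independent of `θ`, where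
`2ρ(x₁,ψ) = (cosψ ∂₂ + sinψ ∂₃)(sinψ ∂₂ - cosψ ∂₃) g₁₁ (x₁,0,0)`. -/
theorem stmt19 (g ginv : R3 → Mat3) (U : Set R3) (hUopen : IsOpen U)
    (hUseg : ∀ s : ℝ, |s| < 1 → axisPt s ∈ U)
    (hsmooth : ∀ i j : Fin 3, ContDiffOn ℝ (⊤ : ℕ∞) (fun x => g x i j) U)
    (hsym : ∀ x ∈ U, (g x).IsSymm) (hpos : ∀ x ∈ U, (g x).PosDef)
    (hinv : ∀ x ∈ U, g x * ginv x = 1)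
    (hF1 : FermiF1 g U) (hF2 : FermiF2 g U)
    (x₁ ψ : ℝ) (hx : axisPt x₁ ∈ U) :
    ∃ C : ℝ, ∀ θ ∈ Set.Icc (-1:ℝ) 1, ∀ T : ℝ, 0 < T → ∀ γ : ℝ → R3,
      ContDiffOn ℝ (⊤ : ℕ∞) γ (Set.Ioo (-T) T) →
      Set.MapsTo γ (Set.Ioo (-T) T) U →
      IsGeodesic g ginv γ T →
      γ 0 = axisPt x₁ →
      deriv γ 0 = ![Real.cos θ, Real.cos ψ * Real.sin θ, Real.sin ψ * Real.sin θ] →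
      iteratedDeriv 2 γ 0 = 0 ∧
      |iteratedDeriv 3 (fun t => -Real.sin ψ * γ t 1 + Real.cos ψ * γ t 2) 0 -
          ((Real.cos ψ *
              pd 1 (fun x => Real.sin ψ * pd 1 (fun y => g y 0 0) x -
                Real.cos ψ * pd 2 (fun y => g y 0 0) x) (axisPt x₁) +
            Real.sin ψ *
              pd 2 (fun x => Real.sin ψ * pd 1 (fun y => g y 0 0) x -
                Real.cos ψ * pd 2 (fun y => g y 0 0) x) (axisPt x₁)) / 2) *
          Real.cos θ ^ 2 * Real.sin θ| ≤ C * θ ^ 2 := by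
  set p := axisPt x₁ with hp
  let B : Fin 3 → Fin 3 → Fin 3 → ℝ := fun i j m =>
    -Real.sin ψ * pd m (Γlow g i j 1) p + Real.cos ψ * pd m (Γlow g i j 2) p
  refine ⟨∑ i, ∑ j, ∑ m, |B i j m|, fun θ _ T hT γ hγ hmaps hgeo h0 hv => ?_⟩
  refine ⟨hgeo.iteratedDeriv_two_eq_zero hUopen hsmooth hF2 hx hT h0, ?_⟩
  have hγ0 : ContDiffAt ℝ (3 : ℕ) γ 0 :=
    contDiffAt_infty.mp (hγ.contDiffAt (isOpen_Ioo.mem_nhds ⟨by linarith, hT⟩)) 3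
  have hperp : iteratedDeriv 3 (fun t => -Real.sin ψ * γ t 1 + Real.cos ψ * γ t 2) 0 =
      ∑ i, ∑ j, (∑ m, B i j m * deriv γ 0 m) * (deriv γ 0 i * deriv γ 0 j) := by
    have h := ContinuousLinearMap.iteratedDeriv_comp_left
      ((-Real.sin ψ) • ContinuousLinearMap.proj (R := ℝ) (φ := fun _ : Fin 3 => ℝ) 1 +
        Real.cos ψ • ContinuousLinearMap.proj (R := ℝ) (φ := fun _ : Fin 3 => ℝ) 2) hγ0
    have h3 := hgeo.iteratedDeriv_three hUopen hsmooth hinv hF2 hx hT hγ hmaps h0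
    simp only [add_apply, smul_apply, ContinuousLinearMap.proj_apply, smul_eq_mul, h3] at h
    rw [h]
    simp only [B, Fin.sum_univ_three]
    ring
  have hd (l : Fin 3) : DifferentiableAt ℝ (pd l fun y => g y 0 0) p :=
    (contDiffOn_pd hUopen (hsmooth 0 0) l).differentiableAt_of_isOpen hUopen hx
  have hpd (m : Fin 3) : pd m (fun x => Real.sin ψ * pd 1 (fun y => g y 0 0) x -
      Real.cos ψ * pd 2 (fun y => g y 0 0) x) p / 2 = B 0 0 m := by
    simp only [sub_eq_add_neg, ← neg_mul]
    rw [pd_add ((hd 1).const_mul _) ((hd 2).const_mul _), pd_const_mul (hd 1),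
      pd_const_mul (hd 2)]
    simp only [B, hp, pd_Γlow_zero_zero_axis hUopen hsmooth hF2 hx]
    ring
  have hB (i j : Fin 3) : B i j 0 = 0 := by
    simp [B, hp, pd_zero_Γlow_axis hUopen hsmooth hF2 hx]
  have hbound := abs_cubic_sub_le B hB (deriv γ 0) (Real.sin θ)
    (by simpa [hv] using Real.abs_cos_le_one θ) (Real.abs_sin_le_one θ)
    (by simpa [hv, abs_mul] using
      mul_le_of_le_one_left (abs_nonneg (Real.sin θ)) (Real.abs_cos_le_one ψ))
    (by simpa [hv, abs_mul] using
      mul_le_of_le_one_left (abs_nonneg (Real.sin θ)) (Real.abs_sin_le_one ψ))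
  have hsin : Real.sin θ ^ 2 ≤ θ ^ 2 := sq_le_sq.mpr Real.abs_sin_le_abs
  refine le_trans (le_of_eq ?_) (hbound.trans (mul_le_mul_of_nonneg_left hsin (by positivity)))
  rw [hperp, ← hpd 1, ← hpd 2]
  congr 2
  simp only [hv, Matrix.cons_val_zero, Matrix.cons_val_one, Matrix.cons_val]
  ring
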